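/- For every S ⊆ 𝒫, lim_{x→∞} ∏_{p prime, p ≤ x} P_p(S) = sup { lim_{x→∞} ∏_{p prime, p ≤ x} P_p(S') : S' ⊆ S finite }. (The global Cohen–Lenstra value of a uniform property is exhausted by its finite sub-properties.) -/

import Mathlib

open Filter Topology

/-- The type of all integer partitions (of all natural numbers `n`). -/
def PartitionsAll : Type := Σ n : ℕ, Nat.Partition n

/-- The empty partition of `0`. -/
def partZero : PartitionsAll := ⟨0, ⟨0, by simp, rfl⟩⟩

/-- The unique partition of `1`. -/
def partOne : PartitionsAll :=
  ⟨1, ⟨{1}, by intro i hi; rw [Multiset.mem_singleton] at hi; omega, rfl⟩⟩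

instance : Zero PartitionsAll := ⟨partZero⟩

/-- The set of isomorphism classes of finite abelian groups, identified with the
finitely supported families of partitions indexed by the primes. -/
abbrev GG : Type := Nat.Primes →₀ PartitionsAll

/-- The finite abelian `p`-group `⊕ⱼ ℤ/p^{λ_j}ℤ` corresponding to a partition `λ`. -/
abbrev pGroup (p : ℕ) (lam : PartitionsAll) : Type :=
  ∀ i : Fin lam.2.parts.toList.length, ZMod (p ^ lam.2.parts.toList.get i)

/-- The Cohen–Lenstra weight `w_p(λ) = 1/#Aut(G_{p,λ})`. -/
noncomputable def wCL (p : ℕ) (lam : PartitionsAll) : ℝ :=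
  ((Nat.card (AddAut (pGroup p lam)) : ℝ))⁻¹

/-- `∏_{i=1}^∞ (1 - p^{-i})`. -/
noncomputable def clC (p : ℕ) : ℝ := ∏' i : ℕ, (1 - ((p : ℝ))⁻¹ ^ (i + 1))

/-- The local Cohen–Lenstra probability `P_p(S) = (∑_{λ∈S} w_p(λ)) ∏_{i≥1}(1-p^{-i})`. -/
noncomputable def Pp (p : ℕ) (S : Set PartitionsAll) : ℝ :=
  (∑' lam : S, wCL p lam) * clC p

/-- The primes `≤ x`. -/
def primesUpTo (x : ℕ) : Finset ℕ := Nat.primesBelow (x + 1)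

/-- The partial products `∏_{p ≤ x} P_p(S)`. -/
noncomputable def globPartial (S : Set PartitionsAll) (x : ℕ) : ℝ :=
  ∏ p ∈ primesUpTo x, Pp p S

/-- The global value `lim_{x→∞} ∏_{p ≤ x} P_p(S)` (the limit exists since all
factors lie in `[0,1]`). -/
noncomputable def glob (S : Set PartitionsAll) : ℝ :=
  limUnder atTop (globPartial S)

/-- `O(S) = {G : G_p ∈ S for all primes p}`. -/
def Oset (S : Set PartitionsAll) : Set GG := {G : GG | ∀ p : Nat.Primes, G p ∈ S}

/-- `O(E₁, …, E_r) = O(E₁) ∪ … ∪ O(E_r)`. -/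
def OOset {r : ℕ} (E : Fin r → Set PartitionsAll) : Set GG := ⋃ i, Oset (E i)

/-- Inclusion–exclusion value of `O(E₁, …, E_r)`. -/
noncomputable def PO {r : ℕ} (E : Fin r → Set PartitionsAll) : ℝ :=
  ∑ T ∈ Finset.univ.filter (fun T : Finset (Fin r) => T.Nonempty),
    (-1 : ℝ) ^ (T.card + 1) * glob (⋂ i ∈ T, E i)

/-- The collection `𝔇` of sets `D(E₁,…,E_r;F₁,…,F_s)`. -/
def DD : Set (Set GG) :=
  {A | ∃ (r s : ℕ) (E : Fin r → Set PartitionsAll) (F : Fin s → Set PartitionsAll),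
      OOset F ⊆ OOset E ∧ A = OOset E \ OOset F}

/-- The value `P(D)` of a set `D ∈ 𝔇` (well-defined: it depends only on the set `D`). -/
noncomputable def PDval (A : Set GG) : ℝ :=
  sSup {x : ℝ | ∃ (r s : ℕ) (E : Fin r → Set PartitionsAll) (F : Fin s → Set PartitionsAll),
      OOset F ⊆ OOset E ∧ A = OOset E \ OOset F ∧ x = PO E - PO F}

/-- The outer measure `ν`. -/
noncomputable def nuCL (A : Set GG) : ℝ :=
  sInf {x : ℝ | ∃ C : ℕ → Set GG, (∀ i, C i ∈ DD) ∧ A ⊆ ⋃ i, C i ∧ x = ∑' i, PDval (C i)}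

/-- The order of a finite abelian group. -/
def ordG (G : GG) : ℕ := G.prod fun p lam => (p : ℕ) ^ lam.1

/-- The exponent of a finite abelian group. -/
def expG (G : GG) : ℕ := G.prod fun p lam => (p : ℕ) ^ lam.2.parts.sup

theorem card_addAut_mul_card_addMonoidHom_le (A B : Type*) [AddCommGroup A] [AddCommGroup B]
    [Finite A] [Finite B] :
    Nat.card (AddAut A) * Nat.card (AddAut B) * Nat.card (A →+ B) ≤
      Nat.card (AddAut (A × B)) := by
  rw [← Nat.card_prod, ← Nat.card_prod]
  have : Finite (AddAut (A × B)) := Finite.of_injective (fun e => (e : A × B → A × B))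
    DFunLike.coe_injective
  let F : (AddAut A × AddAut B) × (A →+ B) → AddAut (A × B) := fun t =>
    { toFun := fun x => (t.1.1 x.1, t.1.2 x.2 + t.2 x.1)
      invFun := fun y => (t.1.1.symm y.1, t.1.2.symm (y.2 - t.2 (t.1.1.symm y.1)))
      left_inv := fun x => by simp
      right_inv := fun y => by simp
      map_add' := fun x y => by ext <;> simp [add_add_add_comm] }
  refine Nat.card_le_card_of_injective F ?_
  rintro ⟨⟨α, β⟩, h⟩ ⟨⟨α', β'⟩, h'⟩ heq
  have key : ∀ a b, α a = α' a ∧ β b + h a = β' b + h' a := fun a b => by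
    have := congrArg (fun e : AddAut (A × B) => e (a, b)) heq
    simpa [F, Prod.ext_iff] using this
  obtain rfl : α = α' := AddEquiv.ext fun a => (key a 0).1
  obtain rfl : β = β' := AddEquiv.ext fun b => by simpa using (key 0 b).2
  obtain rfl : h = h' := AddMonoidHom.ext fun a => by simpa using (key a 0).2
  rfl

/-- The finite abelian `p`-group `⊕ⱼ ℤ/p^{l_j}ℤ` attached to a list of exponents. -/
abbrev listGroup (p : ℕ) (l : List ℕ) : Type := ∀ i : Fin l.length, ZMod (p ^ l.get i)

/-- Splitting off the first cyclic factor of `listGroup`. -/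
def listGroupConsEquiv (p a : ℕ) (l : List ℕ) :
    ZMod (p ^ a) × listGroup p l ≃+ listGroup p (a :: l) where
  toFun x := Fin.cons (α := fun i : Fin (l.length + 1) => ZMod (p ^ (a :: l).get i)) x.1 x.2
  invFun y := (y (0 : Fin (l.length + 1)), fun i => y i.succ)
  left_inv x := rfl
  right_inv y := by
    funext i
    exact Fin.cases (motive := fun i : Fin (l.length + 1) => Fin.cons
      (α := fun i : Fin (l.length + 1) => ZMod (p ^ (a :: l).get i))
      (y (0 : Fin (l.length + 1))) (fun i => y i.succ) i = y i) rfl (fun _ => rfl) i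
  map_add' x y := by
    funext i
    exact Fin.cases (motive := fun i : Fin (l.length + 1) => Fin.cons
      (α := fun i : Fin (l.length + 1) => ZMod (p ^ (a :: l).get i)) (x + y).1 (x + y).2 i =
      Fin.cons (α := fun i : Fin (l.length + 1) => ZMod (p ^ (a :: l).get i)) x.1 x.2 i +
      Fin.cons (α := fun i : Fin (l.length + 1) => ZMod (p ^ (a :: l).get i)) y.1 y.2 i)
      rfl (fun _ => rfl) i

theorem card_addAut_listGroup_nil (p : ℕ) : Nat.card (AddAut (listGroup p [])) = 1 := by
  have : Subsingleton (listGroup p []) :=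
    inferInstanceAs (Subsingleton (∀ i : Fin 0, ZMod (p ^ [].get i)))
  rw [Nat.card_eq_one_iff_unique]
  exact ⟨⟨fun f g => AddEquiv.ext fun x => Subsingleton.elim _ _⟩, ⟨AddEquiv.refl _⟩⟩

theorem exists_injective_zmod_prime_pow (p b : ℕ) [Fact p.Prime] (hb : 0 < b) :
    ∃ f : ZMod p →+ ZMod (p ^ b), Function.Injective f := by
  have hp := (Fact.out : p.Prime).pos
  obtain ⟨b, rfl⟩ : ∃ c, b = c + 1 := ⟨b - 1, by omega⟩
  refine ⟨ZMod.lift p ⟨(zmultiplesHom _ ((p ^ b : ℕ) : ZMod (p ^ (b + 1)))), ?_⟩, ?_⟩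
  · simp only [zmultiplesHom_apply, natCast_zsmul, nsmul_eq_mul, ← Nat.cast_mul]
    rw [ZMod.natCast_eq_zero_iff, pow_succ']
  · rw [ZMod.lift_injective]
    intro m hm
    simp only [zmultiplesHom_apply, zsmul_eq_mul] at hm
    rw [← Int.cast_natCast, ← Int.cast_mul, ZMod.intCast_zmod_eq_zero_iff_dvd] at hm
    rw [ZMod.intCast_zmod_eq_zero_iff_dvd]
    push_cast at hm
    rw [pow_succ'] at hm
    exact Int.dvd_of_mul_dvd_mul_right (by positivity) hm

theorem pow_length_le_card_addMonoidHom (p a : ℕ) [Fact p.Prime] (ha : 0 < a) (l : List ℕ)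
    (hl : ∀ b ∈ l, 0 < b) :
    p ^ l.length ≤ Nat.card (ZMod (p ^ a) →+ listGroup p l) := by
  have : Finite (ZMod (p ^ a) →+ listGroup p l) := Finite.of_injective
    (fun e => (e : ZMod (p ^ a) → listGroup p l)) DFunLike.coe_injective
  choose ι hι using fun i : Fin l.length =>
    exists_injective_zmod_prime_pow p (l.get i) (hl _ (l.get_mem i))
  let r : ZMod (p ^ a) →+* ZMod p := ZMod.castHom (dvd_pow_self p ha.ne') (ZMod p)
  let F : (Fin l.length → ZMod p) → (ZMod (p ^ a) →+ listGroup p l) := fun c =>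
    AddMonoidHom.mk' (fun x i => ι i (c i * r x)) (fun x y => by ext i; simp [mul_add])
  have hF : Function.Injective F := fun c c' h => by
    funext i
    have := congrFun (DFunLike.congr_fun h 1) i
    exact hι i (by simpa [F] using this)
  simpa using Nat.card_le_card_of_injective F hF

/-- The exponent of `p` in the lower bound for the number of automorphisms of `listGroup p l`. -/
def autExponent : List ℕ → ℕ
  | [] => 0
  | a :: l => a + l.length + autExponent l

theorem pow_le_two_mul_card_addAut_zmod (p a : ℕ) [Fact p.Prime] (ha : 0 < a) :
    p ^ a ≤ 2 * Nat.card (AddAut (ZMod (p ^ a))) := by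
  have hp := (Fact.out : p.Prime)
  obtain ⟨b, rfl⟩ : ∃ c, a = c + 1 := ⟨a - 1, by omega⟩
  rw [Nat.card_congr ((ZMod.AddAutEquivUnits _).toEquiv.trans Additive.toMul),
    Nat.card_eq_fintype_card, ZMod.card_units_eq_totient, Nat.totient_prime_pow_succ hp]
  have h2 := hp.two_le
  calc p ^ (b + 1) = p ^ b * p := pow_succ _ _
    _ ≤ p ^ b * (2 * (p - 1)) := Nat.mul_le_mul_left _ (by omega)
    _ = _ := by ring

theorem pow_autExponent_le (p : ℕ) [Fact p.Prime] (l : List ℕ) (hl : ∀ b ∈ l, 0 < b) :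
    p ^ autExponent l ≤ 2 ^ l.length * Nat.card (AddAut (listGroup p l)) := by
  induction l with
  | nil =>
    rw [card_addAut_listGroup_nil]
    simp [autExponent]
  | cons a l ih =>
    have ih := ih fun b hb => hl b (List.mem_cons_of_mem _ hb)
    have ha := pow_le_two_mul_card_addAut_zmod p a (hl a List.mem_cons_self)
    have hh := pow_length_le_card_addMonoidHom p a (hl a List.mem_cons_self) l
      fun b hb => hl b (List.mem_cons_of_mem _ hb)
    have hc : Nat.card (AddAut (listGroup p (a :: l))) =
        Nat.card (AddAut (ZMod (p ^ a) × listGroup p l)) :=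
      Nat.card_congr (AddAut.congr (listGroupConsEquiv p a l)).symm.toEquiv
    rw [hc]
    calc p ^ autExponent (a :: l) = p ^ a * p ^ autExponent l * p ^ l.length := by
          simp only [autExponent]; ring
      _ ≤ (2 * Nat.card (AddAut (ZMod (p ^ a)))) *
          (2 ^ l.length * Nat.card (AddAut (listGroup p l))) *
          Nat.card (ZMod (p ^ a) →+ listGroup p l) := by gcongr
      _ = 2 ^ (l.length + 1) * (Nat.card (AddAut (ZMod (p ^ a))) *
          Nat.card (AddAut (listGroup p l)) * Nat.card (ZMod (p ^ a) →+ listGroup p l)) := by ring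
      _ ≤ _ := Nat.mul_le_mul_left _ (card_addAut_mul_card_addMonoidHom_le _ _)

/-- The value at `p = 2` of the upper bound for the weights; it dominates all of them. -/
noncomputable def listWeight (l : List ℕ) : ℝ := 2 ^ l.length * (1 / 2) ^ autExponent l

theorem hasSum_listWeight_ofFn (k : ℕ) :
    HasSum (fun f : Fin k → ℕ => listWeight (List.ofFn f))
      (∏ i ∈ Finset.range k, 4 * (1 / 2 : ℝ) ^ i) := by
  induction k with
  | zero =>
    simp [listWeight, autExponent]
  | succ k ih =>
    rw [← (Fin.consEquiv fun _ : Fin (k + 1) => ℕ).hasSum_iff, Finset.prod_range_succ, mul_comm]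
    have hg : HasSum (fun a : ℕ => 2 * (1 / 2 : ℝ) ^ k * (1 / 2) ^ a)
        (4 * (1 / 2 : ℝ) ^ k) := by
      have h := hasSum_geometric_two.mul_left (2 * (1 / 2 : ℝ) ^ k)
      rwa [show 2 * (1 / 2 : ℝ) ^ k * 2 = 4 * (1 / 2) ^ k by ring] at h
    have hnn : ∀ l, 0 ≤ listWeight l := fun l => by unfold listWeight; positivity
    have h := hg.mul ih (hg.summable.mul_of_nonneg ih.summable (fun a => by positivity)
      fun f => hnn _)
    refine (congrArg (fun F => HasSum F _) (funext ?_)).mpr h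
    rintro ⟨a, f⟩
    simp only [Function.comp_apply, Fin.consEquiv, Equiv.coe_fn_mk, listWeight, List.ofFn_succ,
      Fin.cons_zero, Fin.cons_succ, autExponent, List.length_cons, List.length_ofFn]
    ring

theorem summable_listWeight : Summable listWeight := by
  have hnn : ∀ l, 0 ≤ listWeight l := fun l => by unfold listWeight; positivity
  rw [← (List.equivSigmaTuple (α := ℕ)).symm.summable_iff,
    summable_sigma_of_nonneg (f := listWeight ∘ _) (fun x => hnn _)]
  refine ⟨fun k => (hasSum_listWeight_ofFn k).summable, ?_⟩
  have : (fun k => ∑' f : Fin k → ℕ, (listWeight ∘ (List.equivSigmaTuple (α := ℕ)).symm) ⟨k, f⟩) =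
      fun k => ∏ i ∈ Finset.range k, 4 * (1 / 2 : ℝ) ^ i :=
    funext fun k => (hasSum_listWeight_ofFn k).tsum_eq
  rw [this]
  refine summable_of_ratio_test_tendsto_lt_one (l := 0) one_pos
    (Eventually.of_forall fun k => (Finset.prod_pos fun i _ => by positivity).ne') ?_
  have h : ∀ k : ℕ, ‖∏ i ∈ Finset.range (k + 1), 4 * (1 / 2 : ℝ) ^ i‖ /
      ‖∏ i ∈ Finset.range k, 4 * (1 / 2 : ℝ) ^ i‖ = 4 * (1 / 2 : ℝ) ^ k := fun k => by
    have hpos : 0 < ∏ i ∈ Finset.range k, 4 * (1 / 2 : ℝ) ^ i :=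
      Finset.prod_pos fun i _ => by positivity
    rw [← norm_div, Finset.prod_range_succ, mul_div_cancel_left₀ _ hpos.ne',
      Real.norm_of_nonneg (by positivity)]
  simp_rw [h]
  simpa using (tendsto_pow_atTop_nhds_zero_of_lt_one (by norm_num : (0 : ℝ) ≤ 1 / 2)
    (by norm_num)).const_mul 4

/-- The parts of a partition, as a list. -/
noncomputable def partsList (lam : PartitionsAll) : List ℕ := lam.2.parts.toList

theorem partsList_injective : Function.Injective partsList := by
  rintro ⟨m, P⟩ ⟨n, Q⟩ h
  have h' : P.parts = Q.parts := by
    have := congrArg (fun l : List ℕ => (l : Multiset ℕ)) h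
    simpa [partsList] using this
  obtain rfl : m = n := by rw [← P.parts_sum, ← Q.parts_sum, h']
  rw [Nat.Partition.ext h']

theorem partsList_pos (lam : PartitionsAll) : ∀ b ∈ partsList lam, 0 < b := fun b hb =>
  lam.2.parts_pos (by simpa [partsList] using hb)

theorem partsList_partZero : partsList partZero = [] := Multiset.toList_zero

theorem partsList_partOne : partsList partOne = [1] := Multiset.toList_singleton 1

theorem wCL_eq (p : ℕ) (lam : PartitionsAll) :
    wCL p lam = (Nat.card (AddAut (listGroup p (partsList lam))) : ℝ)⁻¹ := rfl

theorem wCL_nonneg (p : ℕ) (lam : PartitionsAll) : 0 ≤ wCL p lam := by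
  rw [wCL_eq]; positivity

theorem wCL_partZero (p : ℕ) : wCL p partZero = 1 := by
  rw [wCL_eq, partsList_partZero, card_addAut_listGroup_nil, Nat.cast_one, inv_one]

theorem wCL_partOne {p : ℕ} (hp : p.Prime) : wCL p partOne = ((p : ℝ) - 1)⁻¹ := by
  have : Fact p.Prime := ⟨hp⟩
  rw [wCL_eq, partsList_partOne]
  let e : listGroup p [1] ≃+ ZMod (p ^ 1) :=
    { toFun := fun x => x (0 : Fin 1)
      invFun := fun y => Fin.cons (α := fun i : Fin 1 => ZMod (p ^ [1].get i)) y (fun i => i.elim0)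
      left_inv := fun x => by
        funext i
        exact Fin.cases (motive := fun i : Fin 1 => Fin.cons
          (α := fun i : Fin 1 => ZMod (p ^ [1].get i)) (x (0 : Fin 1)) (fun i => i.elim0) i = x i)
          rfl (fun i => i.elim0) i
      right_inv := fun y => rfl
      map_add' := fun x y => rfl }
  rw [Nat.card_congr ((AddAut.congr e).toEquiv.trans
      ((ZMod.AddAutEquivUnits _).toEquiv.trans Additive.toMul)),
    Nat.card_eq_fintype_card, ZMod.card_units_eq_totient, Nat.totient_prime_pow_succ hp]
  simp [hp.one_le]

theorem wCL_le_pow {p : ℕ} (hp : p.Prime) (lam : PartitionsAll) :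
    wCL p lam ≤ 2 ^ (partsList lam).length * (1 / p : ℝ) ^ autExponent (partsList lam) := by
  have : Fact p.Prime := ⟨hp⟩
  have h := pow_autExponent_le p (partsList lam) (partsList_pos lam)
  have hp0 : (0 : ℝ) < p := mod_cast hp.pos
  rw [wCL_eq]
  set c := Nat.card (AddAut (listGroup p (partsList lam)))
  have h' : (p : ℝ) ^ autExponent (partsList lam) ≤ 2 ^ (partsList lam).length * c := mod_cast h
  have hc : 0 < (c : ℝ) := by
    by_contra hc
    have : (c : ℝ) = 0 := le_antisymm (not_lt.1 hc) (by positivity)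
    rw [this, mul_zero] at h'
    exact absurd h' (not_le.2 (by positivity))
  rw [one_div, inv_pow, ← div_eq_mul_inv, inv_eq_one_div, div_le_div_iff₀ hc (by positivity)]
  linarith

theorem wCL_le_listWeight {p : ℕ} (hp : p.Prime) (lam : PartitionsAll) :
    wCL p lam ≤ listWeight (partsList lam) := by
  refine (wCL_le_pow hp lam).trans ?_
  have : (2 : ℝ) ≤ p := mod_cast hp.two_le
  unfold listWeight
  gcongr

theorem two_le_autExponent {lam : PartitionsAll} (h0 : lam ≠ partZero) (h1 : lam ≠ partOne) :
    2 ≤ autExponent (partsList lam) := by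
  have h0' : partsList lam ≠ [] := fun h =>
    h0 (partsList_injective (h.trans partsList_partZero.symm))
  have h1' : partsList lam ≠ [1] := fun h =>
    h1 (partsList_injective (h.trans partsList_partOne.symm))
  have hpos := partsList_pos lam
  generalize partsList lam = l at *
  match l with
  | [] => simp at h0'
  | [a] =>
    have : 0 < a := hpos a (by simp)
    have : a ≠ 1 := by simpa using h1'
    simp only [autExponent, List.length_nil]
    omega
  | a :: b :: l =>
    have : 0 < a := hpos a (by simp)
    simp only [autExponent, List.length_cons]
    omega

theorem wCL_le_of_ne {p : ℕ} (hp : p.Prime) {lam : PartitionsAll} (h0 : lam ≠ partZero)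
    (h1 : lam ≠ partOne) : wCL p lam ≤ 4 / (p : ℝ) ^ 2 * listWeight (partsList lam) := by
  refine (wCL_le_pow hp lam).trans ?_
  have hp2 : (2 : ℝ) ≤ p := mod_cast hp.two_le
  obtain ⟨e, he⟩ := Nat.exists_eq_add_of_le (two_le_autExponent h0 h1)
  unfold listWeight
  rw [he, pow_add, pow_add]
  calc (2 : ℝ) ^ (partsList lam).length * ((1 / p) ^ 2 * (1 / p) ^ e)
      ≤ 2 ^ (partsList lam).length * ((1 / p) ^ 2 * (1 / 2) ^ e) := by gcongr
    _ = _ := by field_simp; norm_num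

theorem summable_indicator_wCL {p : ℕ} (hp : p.Prime) (S : Set PartitionsAll) :
    Summable (S.indicator (wCL p)) :=
  ((summable_listWeight.comp_injective partsList_injective).of_nonneg_of_le (wCL_nonneg p)
    (wCL_le_listWeight hp)).indicator S

theorem Pp_eq (p : ℕ) (S : Set PartitionsAll) :
    Pp p S = (∑' lam, S.indicator (wCL p) lam) * clC p := by
  rw [Pp, tsum_subtype]

/-- The sum of the dominating weights over all partitions. -/
noncomputable def totalWeight : ℝ := ∑' lam : PartitionsAll, listWeight (partsList lam)

theorem totalWeight_nonneg : 0 ≤ totalWeight :=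
  tsum_nonneg fun _ => by unfold listWeight; positivity

theorem partZero_ne_partOne : partZero ≠ partOne := fun h => by
  have := congrArg partsList h
  rw [partsList_partZero, partsList_partOne] at this
  simp at this

theorem exists_tsum_indicator_wCL_eq {p : ℕ} (hp : p.Prime) (S : Set PartitionsAll) :
    ∃ t : ℝ, 0 ≤ t ∧ t ≤ 4 * totalWeight / (p : ℝ) ^ 2 ∧
      ∑' lam, S.indicator (wCL p) lam =
        S.indicator (wCL p) partZero + S.indicator (wCL p) partOne + t := by
  classical
  set R : Set PartitionsAll := S \ {partZero, partOne} with hR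
  refine ⟨∑' lam, R.indicator (wCL p) lam,
    tsum_nonneg fun lam => Set.indicator_nonneg (fun _ _ => wCL_nonneg p _) lam, ?_, ?_⟩
  · have hs : Summable fun lam => 4 / (p : ℝ) ^ 2 * listWeight (partsList lam) :=
      (summable_listWeight.comp_injective partsList_injective).mul_left _
    refine ((summable_indicator_wCL hp R).tsum_le_tsum (fun lam => ?_) hs).trans_eq ?_
    · refine Set.indicator_apply_le' (fun h => ?_) fun _ => by unfold listWeight; positivity
      simp only [hR, Set.mem_sdiff, Set.mem_insert_iff, Set.mem_singleton_iff, not_or] at h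
      exact wCL_le_of_ne hp h.2.1 h.2.2
    · rw [tsum_mul_left, totalWeight]; ring
  · have h : ∀ lam, S.indicator (wCL p) lam =
        ((if lam = partZero then S.indicator (wCL p) partZero else 0) +
          (if lam = partOne then S.indicator (wCL p) partOne else 0)) +
        R.indicator (wCL p) lam := fun lam => by
      have hne := partZero_ne_partOne
      by_cases h0 : lam = partZero
      · subst h0; simp [hR, hne]
      · by_cases h1 : lam = partOne
        · subst h1; simp [hR, h0]
        · by_cases hS : lam ∈ S <;> simp [hR, h0, h1, hS]
    have e0 := hasSum_ite_eq partZero (S.indicator (wCL p) partZero)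
    have e1 := hasSum_ite_eq partOne (S.indicator (wCL p) partOne)
    rw [tsum_congr h]
    exact ((e0.add e1).add (summable_indicator_wCL hp R).hasSum).tsum_eq

theorem exists_clC_eq {p : ℕ} (hp : p.Prime) :
    ∃ r : ℝ, 0 ≤ r ∧ r ≤ 1 ∧ 1 - r ≤ 4 / (p : ℝ) ^ 2 ∧ clC p = (1 - 1 / (p : ℝ)) * r := by
  have hp2 : (2 : ℝ) ≤ p := mod_cast hp.two_le
  set x : ℝ := (p : ℝ)⁻¹ with hx
  have hx0 : 0 < x := by positivity
  have hx2 : x ≤ 1 / 2 := by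
    rw [hx, one_div]; gcongr
  have hs0 : Summable fun i : ℕ => x ^ i := summable_geometric_of_lt_one hx0.le (by linarith)
  have hs : Summable fun i : ℕ => x ^ (i + 2) := (summable_nat_add_iff 2).2 hs0
  have hmul : Multipliable fun i : ℕ => 1 + -x ^ (i + 2) :=
    Real.multipliable_one_add_of_summable hs.neg
  have hle1 : ∀ i : ℕ, x ^ (i + 2) ≤ 1 := fun i => pow_le_one₀ hx0.le (by linarith)
  have hr0 : ∀ s : Finset ℕ, 0 ≤ ∏ i ∈ s, (1 + -x ^ (i + 2)) := fun s =>
    Finset.prod_nonneg fun i _ => by linarith [hle1 i]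
  refine ⟨∏' i : ℕ, (1 + -x ^ (i + 2)), ge_of_tendsto' hmul.hasProd hr0,
    le_of_tendsto' hmul.hasProd fun s => Finset.prod_le_one
      (fun i _ => by linarith [hle1 i]) fun i _ => by linarith [pow_pos hx0 (i + 2)], ?_, ?_⟩
  · have hsum : ∑' i : ℕ, x ^ (i + 2) ≤ 2 * x ^ 2 := by
      simp_rw [pow_add]
      rw [tsum_mul_right, tsum_geometric_of_lt_one hx0.le (by linarith)]
      gcongr
      rw [inv_le_comm₀ (by linarith) (by norm_num)]
      linarith
    have hfin : ∀ s : Finset ℕ, 1 - 4 / (p : ℝ) ^ 2 ≤ ∏ i ∈ s, (1 + -x ^ (i + 2)) := fun s => by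
      have h1 := Finset.norm_prod_one_add_sub_one_le s fun i : ℕ => -x ^ (i + 2)
      have h2 : ∑ i ∈ s, ‖-x ^ (i + 2)‖ ≤ 2 * x ^ 2 := by
        simp_rw [norm_neg, Real.norm_of_nonneg (pow_nonneg hx0.le _)]
        exact (hs.sum_le_tsum s fun i _ => by positivity).trans hsum
      have h3 : Real.exp (2 * x ^ 2) - 1 ≤ 4 * x ^ 2 := by
        have hy : 2 * x ^ 2 ≤ 1 / 2 := by nlinarith
        have hy0 : 0 ≤ 2 * x ^ 2 := by positivity
        have h4 := Real.exp_bound_div_one_sub_of_interval hy0 (by linarith)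
        have h5 : 1 / (1 - 2 * x ^ 2) ≤ 1 + 4 * x ^ 2 := by
          rw [div_le_iff₀ (by linarith)]
          nlinarith [mul_nonneg hy0 (sub_nonneg.2 hy)]
        linarith
      have h5 := (abs_le.1 (h1.trans (sub_le_sub_right (Real.exp_le_exp.2 h2) 1))).1
      have h6 : 4 / (p : ℝ) ^ 2 = 4 * x ^ 2 := by rw [hx, inv_pow]; rfl
      rw [h6]
      linarith
    linarith [ge_of_tendsto' hmul.hasProd hfin]
  · have hm' : Multipliable fun i : ℕ => 1 - x ^ (i + 1 + 1) := by
      simpa [sub_eq_add_neg] using hmul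
    have hsplit := tprod_eq_zero_mul' (f := fun i : ℕ => 1 - x ^ (i + 1)) hm'
    rw [zero_add, pow_one] at hsplit
    rw [clC, hsplit, one_div]
    simp only [sub_eq_add_neg, add_assoc, one_add_one_eq_two, hx]

theorem Pp_nonneg {p : ℕ} (hp : p.Prime) (S : Set PartitionsAll) : 0 ≤ Pp p S := by
  obtain ⟨r, hr0, -, -, hc⟩ := exists_clC_eq hp
  have hp1 : 1 / (p : ℝ) ≤ 1 := by
    rw [div_le_one (mod_cast hp.pos)]; exact_mod_cast hp.one_le
  rw [Pp_eq, hc]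
  exact mul_nonneg (tsum_nonneg fun lam => Set.indicator_nonneg (fun _ _ => wCL_nonneg p _) lam)
    (mul_nonneg (by linarith) hr0)

theorem Pp_mono {p : ℕ} (hp : p.Prime) {S T : Set PartitionsAll} (h : S ⊆ T) :
    Pp p S ≤ Pp p T := by
  obtain ⟨r, hr0, -, -, hc⟩ := exists_clC_eq hp
  have hp1 : 1 / (p : ℝ) ≤ 1 := by
    rw [div_le_one (mod_cast hp.pos)]; exact_mod_cast hp.one_le
  rw [Pp_eq, Pp_eq, hc]
  refine mul_le_mul_of_nonneg_right ?_ (mul_nonneg (by linarith) hr0)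
  exact (summable_indicator_wCL hp S).tsum_le_tsum
    (fun lam => Set.indicator_le_indicator_of_subset h (wCL_nonneg p) lam)
    (summable_indicator_wCL hp T)

theorem abs_Pp_sub_one_le {p : ℕ} (hp : p.Prime) {S : Set PartitionsAll} (h0 : partZero ∈ S)
    (h1 : partOne ∈ S) : |Pp p S - 1| ≤ (4 + 4 * totalWeight) / (p : ℝ) ^ 2 := by
  obtain ⟨r, hr0, hr1, hr, hc⟩ := exists_clC_eq hp
  obtain ⟨t, ht0, ht, hs⟩ := exists_tsum_indicator_wCL_eq hp S
  have hp2 : (2 : ℝ) ≤ p := mod_cast hp.two_le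
  have hx0 : 0 < 1 / (p : ℝ) := by positivity
  have hx1 : 1 / (p : ℝ) ≤ 1 := by
    rw [div_le_one (by linarith)]; linarith
  have hpne : (p : ℝ) - 1 ≠ 0 := by linarith
  have hP : Pp p S = r * (1 + (1 - 1 / (p : ℝ)) * t) := by
    rw [Pp_eq, hs, hc, Set.indicator_of_mem h0, Set.indicator_of_mem h1, wCL_partZero,
      wCL_partOne hp]
    field_simp
    ring
  have hu0 : 0 ≤ (1 - 1 / (p : ℝ)) * t := mul_nonneg (by linarith) ht0
  have hu1 : (1 - 1 / (p : ℝ)) * t ≤ t := mul_le_of_le_one_left ht0 (by linarith)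
  rw [hP, abs_le, add_div]
  have hq : 0 ≤ 4 / (p : ℝ) ^ 2 := by positivity
  constructor <;> nlinarith

theorem Pp_le_exp {p : ℕ} (hp : p.Prime) {S : Set PartitionsAll}
    (h : ¬(partZero ∈ S ∧ partOne ∈ S)) :
    Pp p S ≤ Real.exp (4 * totalWeight / (p : ℝ) ^ 2 - 1 / p) := by
  obtain ⟨r, hr0, hr1, hr, hc⟩ := exists_clC_eq hp
  obtain ⟨t, ht0, ht, hs⟩ := exists_tsum_indicator_wCL_eq hp S
  have hp2 : (2 : ℝ) ≤ p := mod_cast hp.two_le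
  have hx0 : 0 < 1 / (p : ℝ) := by positivity
  have hx1 : 1 / (p : ℝ) ≤ 1 := by
    rw [div_le_one (by linarith)]; linarith
  have hw1 : ((p : ℝ) - 1)⁻¹ ≤ 1 := inv_le_one_of_one_le₀ (by linarith)
  have hm : S.indicator (wCL p) partZero + S.indicator (wCL p) partOne ≤ 1 := by
    by_cases h0 : partZero ∈ S <;> by_cases h1 : partOne ∈ S
    · exact absurd ⟨h0, h1⟩ h
    all_goals simp [h0, h1, wCL_partZero, wCL_partOne hp, hw1]
  have hm0 : 0 ≤ S.indicator (wCL p) partZero + S.indicator (wCL p) partOne :=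
    add_nonneg (Set.indicator_nonneg (fun _ _ => wCL_nonneg p _) _)
      (Set.indicator_nonneg (fun _ _ => wCL_nonneg p _) _)
  rw [Pp_eq, hs, hc]
  set m := S.indicator (wCL p) partZero + S.indicator (wCL p) partOne
  calc (m + t) * ((1 - 1 / (p : ℝ)) * r) ≤ (1 + t) * ((1 - 1 / (p : ℝ)) * 1) := by
        have : 0 ≤ 1 - 1 / (p : ℝ) := by linarith
        gcongr
    _ ≤ 4 * totalWeight / (p : ℝ) ^ 2 - 1 / p + 1 := by nlinarith
    _ ≤ _ := Real.add_one_le_exp _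

/-- The deviation from `1` of the `n`-th factor of the global product. -/
noncomputable def deviation (S : Set PartitionsAll) (n : ℕ) : ℝ :=
  if n.Prime then Pp n S - 1 else 0

theorem globPartial_eq_prod_range (S : Set PartitionsAll) (x : ℕ) :
    globPartial S x = ∏ n ∈ Finset.range (x + 1), (1 + deviation S n) := by
  rw [globPartial, primesUpTo, Nat.primesBelow, Finset.prod_filter]
  refine Finset.prod_congr rfl fun n _ => ?_
  unfold deviation
  split_ifs <;> ring

theorem abs_deviation_le {S : Set PartitionsAll} (h0 : partZero ∈ S) (h1 : partOne ∈ S) (n : ℕ) :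
    ‖deviation S n‖ ≤ (4 + 4 * totalWeight) * (1 / (n : ℝ) ^ 2) := by
  have := totalWeight_nonneg
  unfold deviation
  split_ifs with hn
  · rw [mul_one_div]
    exact abs_Pp_sub_one_le hn h0 h1
  · rw [norm_zero]
    positivity

theorem summable_deviation_bound :
    Summable fun n : ℕ => (4 + 4 * totalWeight) * (1 / (n : ℝ) ^ 2) :=
  (Real.summable_one_div_nat_pow.2 one_lt_two).mul_left _

theorem tendsto_globPartial {S : Set PartitionsAll} (h0 : partZero ∈ S) (h1 : partOne ∈ S) :
    Tendsto (globPartial S) atTop (𝓝 (∏' n, (1 + deviation S n))) := by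
  have hm : Multipliable fun n => 1 + deviation S n := multipliable_one_add_of_summable
    (summable_deviation_bound.of_nonneg_of_le (fun _ => norm_nonneg _) (abs_deviation_le h0 h1))
  simpa only [Function.comp_def, ← globPartial_eq_prod_range] using
    hm.hasProd.tendsto_prod_nat.comp (tendsto_add_atTop_nat 1)

theorem tendsto_globPartial_zero {S : Set PartitionsAll} (h : ¬(partZero ∈ S ∧ partOne ∈ S)) :
    Tendsto (globPartial S) atTop (𝓝 0) := by
  have := totalWeight_nonneg
  set f : ℕ → ℝ := {p | p.Prime}.indicator fun n : ℕ => (1 : ℝ) / n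
  have hdiv : Tendsto (fun n : ℕ => ∑ i ∈ Finset.range (n + 1), f i) atTop atTop :=
    ((not_summable_iff_tendsto_nat_atTop_of_nonneg fun n =>
      Set.indicator_nonneg (fun _ _ => by positivity) n).1 not_summable_one_div_on_primes).comp
      (tendsto_add_atTop_nat 1)
  have hs : Summable fun n : ℕ => 4 * totalWeight / (n : ℝ) ^ 2 := by
    simpa only [mul_one_div] using
      (Real.summable_one_div_nat_pow.2 one_lt_two).mul_left (4 * totalWeight)
  have hlim : Tendsto (fun n : ℕ => Real.exp (∑' i : ℕ, 4 * totalWeight / (i : ℝ) ^ 2 -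
      ∑ i ∈ Finset.range (n + 1), f i)) atTop (𝓝 0) :=
    Real.tendsto_exp_atBot.comp
      (tendsto_atBot_add_const_left _ _ (tendsto_neg_atTop_atBot.comp hdiv))
  refine squeeze_zero (fun x => Finset.prod_nonneg fun p hp =>
    Pp_nonneg (Nat.prime_of_mem_primesBelow hp) S) (fun x => ?_) hlim
  have hsum : ∑ i ∈ Finset.range (x + 1), f i = ∑ p ∈ primesUpTo x, 1 / (p : ℝ) := by
    rw [primesUpTo, Nat.primesBelow, Finset.sum_filter]
    exact Finset.sum_congr rfl fun i _ => Set.indicator_apply _ _ _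
  calc globPartial S x
      ≤ ∏ p ∈ primesUpTo x, Real.exp (4 * totalWeight / (p : ℝ) ^ 2 - 1 / p) :=
        Finset.prod_le_prod (fun p hp => Pp_nonneg (Nat.prime_of_mem_primesBelow hp) S)
          fun p hp => Pp_le_exp (Nat.prime_of_mem_primesBelow hp) h
    _ = Real.exp (∑ p ∈ primesUpTo x, 4 * totalWeight / (p : ℝ) ^ 2 -
          ∑ i ∈ Finset.range (x + 1), f i) := by
        rw [← Real.exp_sum, Finset.sum_sub_distrib, hsum]
    _ ≤ _ := by
        gcongr
        exact hs.sum_le_tsum _ fun i _ => by positivity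

theorem glob_eq_zero {S : Set PartitionsAll} (h : ¬(partZero ∈ S ∧ partOne ∈ S)) : glob S = 0 :=
  (tendsto_globPartial_zero h).limUnder_eq

theorem glob_eq_tprod {S : Set PartitionsAll} (h0 : partZero ∈ S) (h1 : partOne ∈ S) :
    glob S = ∏' n, (1 + deviation S n) :=
  (tendsto_globPartial h0 h1).limUnder_eq

theorem tendsto_globPartial_glob (S : Set PartitionsAll) :
    Tendsto (globPartial S) atTop (𝓝 (glob S)) := by
  by_cases h : partZero ∈ S ∧ partOne ∈ S
  · rw [glob_eq_tprod h.1 h.2]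
    exact tendsto_globPartial h.1 h.2
  · rw [glob_eq_zero h]
    exact tendsto_globPartial_zero h

theorem glob_mono {S T : Set PartitionsAll} (h : S ⊆ T) : glob S ≤ glob T :=
  le_of_tendsto_of_tendsto' (tendsto_globPartial_glob S) (tendsto_globPartial_glob T) fun _ =>
    Finset.prod_le_prod (fun _ hp => Pp_nonneg (Nat.prime_of_mem_primesBelow hp) S)
      fun _ hp => Pp_mono (Nat.prime_of_mem_primesBelow hp) h

theorem tendsto_Pp_inter_finset {p : ℕ} (hp : p.Prime) (S : Set PartitionsAll) :
    Tendsto (fun F : Finset PartitionsAll => Pp p (S ∩ ↑F)) atTop (𝓝 (Pp p S)) := by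
  have h : ∀ F : Finset PartitionsAll,
      ∑' lam, (S ∩ ↑F).indicator (wCL p) lam = ∑ lam ∈ F, S.indicator (wCL p) lam := fun F => by
    rw [Set.inter_comm, ← Set.indicator_indicator, ← tsum_subtype, Finset.tsum_subtype']
  simp only [Pp_eq, h]
  exact (summable_indicator_wCL hp S).hasSum.mul_const _

theorem tendsto_glob_inter_finset {S : Set PartitionsAll} (h0 : partZero ∈ S) (h1 : partOne ∈ S) :
    Tendsto (fun F : Finset PartitionsAll => glob (S ∩ ↑F)) atTop (𝓝 (glob S)) := by
  classical
  have hev : ∀ᶠ F : Finset PartitionsAll in atTop, partZero ∈ S ∩ ↑F ∧ partOne ∈ S ∩ ↑F := by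
    filter_upwards [eventually_ge_atTop {partZero, partOne}] with F hF
    exact ⟨⟨h0, hF (by simp)⟩, ⟨h1, hF (by simp)⟩⟩
  have hlim : Tendsto (fun F : Finset PartitionsAll => ∏' n, (1 + deviation (S ∩ ↑F) n)) atTop
      (𝓝 (∏' n, (1 + deviation S n))) := by
    refine tendsto_tprod_one_add_of_dominated_convergence summable_deviation_bound (fun n => ?_)
      (hev.mono fun F hF => abs_deviation_le hF.1 hF.2)
    by_cases hn : n.Prime
    · simpa only [deviation, if_pos hn] using (tendsto_Pp_inter_finset hn S).sub_const 1
    · simpa only [deviation, if_neg hn] using tendsto_const_nhds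
  rw [glob_eq_tprod h0 h1]
  exact hlim.congr' (hev.mono fun F hF => (glob_eq_tprod hF.1 hF.2).symm)

/-- The global Cohen–Lenstra value of a uniform property is exhausted by its finite
sub-properties: `lim_{x→∞} ∏_{p≤x} P_p(S) = sup {lim_{x→∞} ∏_{p≤x} P_p(S') : S' ⊆ S finite}`. -/
theorem glob_eq_sup_finite_subsets (S : Set PartitionsAll) :
    glob S = sSup {x : ℝ | ∃ S' : Set PartitionsAll, S' ⊆ S ∧ S'.Finite ∧ x = glob S'} := by
  by_cases h : partZero ∈ S ∧ partOne ∈ S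
  · have hle : ∀ x ∈ {x : ℝ | ∃ S' : Set PartitionsAll, S' ⊆ S ∧ S'.Finite ∧ x = glob S'},
        x ≤ glob S := by
      rintro x ⟨S', hS', -, rfl⟩
      exact glob_mono hS'
    refine le_antisymm ?_ (csSup_le ⟨_, ∅, Set.empty_subset S, Set.finite_empty, rfl⟩ hle)
    exact le_of_tendsto' (tendsto_glob_inter_finset h.1 h.2) fun F => le_csSup ⟨_, hle⟩
      ⟨S ∩ ↑F, Set.inter_subset_left, F.finite_toSet.inter_of_right S, rfl⟩
  · have hset : {x : ℝ | ∃ S' : Set PartitionsAll, S' ⊆ S ∧ S'.Finite ∧ x = glob S'} = {0} := by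
      ext x
      constructor
      · rintro ⟨S', hS', -, rfl⟩
        exact glob_eq_zero fun h' => h ⟨hS' h'.1, hS' h'.2⟩
      · rintro rfl
        exact ⟨∅, Set.empty_subset S, Set.finite_empty,
          (glob_eq_zero fun h' => Set.notMem_empty _ h'.1).symm⟩
    rw [hset, csSup_singleton, glob_eq_zero h]
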